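/- Let T be an invertible nonsingular ergodic transformation of a σ-finite measure space (X,μ), and suppose T is not weak doubly ergodic. Then there exist measurable sets A, B of positive measure such that the two sets ⋃_{n∈ℤ} (T×T)ⁿ(A×A) and ⋃_{n∈ℤ} (T×T)ⁿ(A×B) intersect in a (μ×μ)-null set, where T×T denotes the product transformation (x,y) ↦ (Tx,Ty). -/

import Mathlib

open MeasureTheory Filter Set
open scoped ENNReal

/-- The `n`-th iterate (for `n ∈ ℤ`) of an invertible transformation. -/
def iterZ {X : Type*} (T : X ≃ X) (n : ℤ) : X → X := ⇑(T ^ n)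

/-- `T` is weak doubly ergodic with respect to `μ`. -/
def WDE {X : Type*} [MeasurableSpace X] (μ : Measure X) (T : X → X) : Prop :=
  ∀ A B : Set X, MeasurableSet A → MeasurableSet B → 0 < μ A → 0 < μ B →
    ∃ n : ℕ, 1 ≤ n ∧ 0 < μ (A ∩ T^[n] '' A) ∧ 0 < μ (B ∩ T^[n] '' A)

section IntegerIterates

variable {X : Type*} [MeasurableSpace X] {μ : Measure X} {T : X ≃ᵐ X}

lemma iterZ_natCast (n : ℕ) : iterZ T.toEquiv n = (⇑T)^[n] := by
  simp only [iterZ, zpow_natCast, ← Equiv.Perm.iterate_eq_pow]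
  rfl

lemma iterZ_neg_natCast (n : ℕ) : iterZ T.toEquiv (-n) = (⇑T.symm)^[n] := by
  simp only [iterZ, zpow_neg, zpow_natCast, ← inv_pow, ← Equiv.Perm.iterate_eq_pow]
  rfl

lemma iterZ_add_apply (m n : ℤ) (x : X) :
    iterZ T.toEquiv (m + n) x = iterZ T.toEquiv m (iterZ T.toEquiv n x) := by
  simp only [iterZ, zpow_add, Equiv.Perm.mul_apply]

lemma preimage_iterZ_preimage (m n : ℤ) (S : Set X) :
    iterZ T.toEquiv m ⁻¹' (iterZ T.toEquiv n ⁻¹' S) = iterZ T.toEquiv (m + n) ⁻¹' S := by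
  ext x
  simp only [mem_preimage, add_comm m n, iterZ_add_apply]

lemma image_iterZ (n : ℤ) (S : Set X) :
    iterZ T.toEquiv n '' S = iterZ T.toEquiv (-n) ⁻¹' S := by
  unfold iterZ
  rw [zpow_neg]
  exact Equiv.image_eq_preimage_symm _ _

lemma iterZ_zero_preimage (S : Set X) : iterZ T.toEquiv 0 ⁻¹' S = S := by
  ext x
  simp [iterZ]

lemma quasiMeasurePreserving_iterZ (hns : Measure.QuasiMeasurePreserving (⇑T) μ μ)
    (hns' : Measure.QuasiMeasurePreserving (⇑T.symm) μ μ) (n : ℤ) :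
    Measure.QuasiMeasurePreserving (iterZ T.toEquiv n) μ μ := by
  obtain ⟨n, rfl | rfl⟩ := n.eq_nat_or_neg
  · rw [iterZ_natCast]
    exact hns.iterate n
  · rw [iterZ_neg_natCast]
    exact hns'.iterate n

lemma measure_preimage_iterZ_eq_zero_iff
    (hT : ∀ n : ℤ, Measure.QuasiMeasurePreserving (iterZ T.toEquiv n) μ μ) (n : ℤ) (S : Set X) :
    μ (iterZ T.toEquiv n ⁻¹' S) = 0 ↔ μ S = 0 := by
  refine ⟨fun h => ?_, (hT n).preimage_null⟩
  have := (hT (-n)).preimage_null h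
  rwa [preimage_iterZ_preimage, neg_add_cancel, iterZ_zero_preimage] at this

lemma measure_preimage_iterZ_inter_eq_zero_iff
    (hT : ∀ n : ℤ, Measure.QuasiMeasurePreserving (iterZ T.toEquiv n) μ μ) (m n : ℤ)
    (R S : Set X) :
    μ (iterZ T.toEquiv m ⁻¹' R ∩ iterZ T.toEquiv n ⁻¹' S) = 0 ↔
      μ (R ∩ iterZ T.toEquiv (n - m) ⁻¹' S) = 0 := by
  rw [← measure_preimage_iterZ_eq_zero_iff hT m (R ∩ _), preimage_inter,
    preimage_iterZ_preimage, add_sub_cancel]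

/-- If no integer `n` is simultaneously a return time of `A` and a hitting time of `B`
from `A`, then the orbits of `A × A` and `A × B` are essentially disjoint. -/
lemma measure_orbit_inter_orbit_eq_zero [SigmaFinite μ]
    (hT : ∀ n : ℤ, Measure.QuasiMeasurePreserving (iterZ T.toEquiv n) μ μ) {A B : Set X}
    (h : ∀ n : ℤ, μ (A ∩ iterZ T.toEquiv n ⁻¹' A) = 0 ∨ μ (A ∩ iterZ T.toEquiv n ⁻¹' B) = 0) :
    (μ.prod μ)
      ((⋃ n : ℤ, (iterZ T.toEquiv n '' A) ×ˢ (iterZ T.toEquiv n '' A)) ∩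
        (⋃ n : ℤ, (iterZ T.toEquiv n '' A) ×ˢ (iterZ T.toEquiv n '' B))) = 0 := by
  simp only [iUnion_inter, inter_iUnion, measure_iUnion_null_iff]
  intro i j
  rw [prod_inter_prod, Measure.prod_prod, mul_eq_zero]
  simp only [image_iterZ, measure_preimage_iterZ_inter_eq_zero_iff hT]
  exact h _

lemma exists_orbits_inter_null [SigmaFinite μ]
    (hT : ∀ n : ℤ, Measure.QuasiMeasurePreserving (iterZ T.toEquiv n) μ μ) {C : Set X}
    (hC : MeasurableSet C) (hpos : 0 < μ C) {k : ℤ} (hk : 1 ≤ k)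
    (h : ∀ n : ℤ, 1 ≤ n →
      μ (C ∩ iterZ T.toEquiv n ⁻¹' C) = 0 ∨ μ (C ∩ iterZ T.toEquiv (k - n) ⁻¹' C) = 0) :
    ∃ A B : Set X, MeasurableSet A ∧ MeasurableSet B ∧ 0 < μ A ∧ 0 < μ B ∧
      (μ.prod μ)
        ((⋃ n : ℤ, (iterZ T.toEquiv n '' A) ×ˢ (iterZ T.toEquiv n '' A)) ∩
          (⋃ n : ℤ, (iterZ T.toEquiv n '' A) ×ˢ (iterZ T.toEquiv n '' B))) = 0 := by
  have hsymm (n : ℤ) : μ (C ∩ iterZ T.toEquiv n ⁻¹' C) = 0 ↔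
      μ (C ∩ iterZ T.toEquiv (-n) ⁻¹' C) = 0 := by
    have := measure_preimage_iterZ_inter_eq_zero_iff hT n 0 C C
    rwa [iterZ_zero_preimage, inter_comm, zero_sub] at this
  refine ⟨C, iterZ T.toEquiv k ⁻¹' C, hC, (hT k).measurable hC, hpos, ?_,
    measure_orbit_inter_orbit_eq_zero hT fun n => ?_⟩
  · rwa [pos_iff_ne_zero, Ne, measure_preimage_iterZ_eq_zero_iff hT, ← Ne, ← pos_iff_ne_zero]
  · rw [preimage_iterZ_preimage]
    rcases le_or_gt 0 n with hn | hn
    · have := h (n + k) (by lia)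
      rw [hsymm (k - _), show -(k - (n + k)) = n by ring] at this
      exact this.symm
    · have := h (-n) (by lia)
      rwa [hsymm (-n), neg_neg, sub_neg_eq_add, add_comm k] at this

lemma exists_orbits_inter_null_of_wandering [SigmaFinite μ]
    (hT : ∀ n : ℤ, Measure.QuasiMeasurePreserving (iterZ T.toEquiv n) μ μ) {C : Set X}
    (hC : MeasurableSet C) (hpos : 0 < μ C)
    (h : ∀ n : ℤ, 1 ≤ n → μ (C ∩ iterZ T.toEquiv n ⁻¹' C) = 0) :
    ∃ A B : Set X, MeasurableSet A ∧ MeasurableSet B ∧ 0 < μ A ∧ 0 < μ B ∧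
      (μ.prod μ)
        ((⋃ n : ℤ, (iterZ T.toEquiv n '' A) ×ˢ (iterZ T.toEquiv n '' A)) ∩
          (⋃ n : ℤ, (iterZ T.toEquiv n '' A) ×ˢ (iterZ T.toEquiv n '' B))) = 0 :=
  exists_orbits_inter_null hT hC hpos le_rfl fun n hn => .inl (h n hn)

lemma exists_int_measure_inter_preimage_ne_zero
    (hT : ∀ n : ℤ, Measure.QuasiMeasurePreserving (iterZ T.toEquiv n) μ μ)
    (herg : ∀ A : Set X, MeasurableSet A → ⇑T ⁻¹' A = A → μ A = 0 ∨ μ Aᶜ = 0)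
    {A B : Set X} (hB : MeasurableSet B) (hA0 : μ A ≠ 0) (hB0 : μ B ≠ 0) :
    ∃ k : ℤ, μ (A ∩ iterZ T.toEquiv k ⁻¹' B) ≠ 0 := by
  by_contra! hnull
  have hTone : ⇑T = iterZ T.toEquiv 1 := by
    simpa using (iterZ_natCast (T := T) 1).symm
  rcases herg (⋃ k : ℤ, iterZ T.toEquiv k ⁻¹' B)
    (.iUnion fun k => (hT k).measurable hB) (by
      simp only [hTone, preimage_iUnion, preimage_iterZ_preimage]
      exact (Equiv.addLeft (1 : ℤ)).surjective.iUnion_comp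
        fun k => iterZ T.toEquiv k ⁻¹' B) with h | h
  · rw [measure_iUnion_null_iff] at h
    exact hB0 ((measure_preimage_iterZ_eq_zero_iff hT 0 B).1 (h 0))
  · refine hA0 (measure_mono_null ?_ (measure_union_null (measure_iUnion_null hnull) h))
    rw [← inter_iUnion]
    intro x hx
    by_cases hxU : x ∈ ⋃ k : ℤ, iterZ T.toEquiv k ⁻¹' B
    exacts [.inl ⟨hx, hxU⟩, .inr hxU]

lemma exists_nat_measure_inter_preimage_ne_zero_of_conservative
    (hcons : Conservative (⇑T) μ)
    (hT : ∀ n : ℤ, Measure.QuasiMeasurePreserving (iterZ T.toEquiv n) μ μ)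
    (herg : ∀ A : Set X, MeasurableSet A → ⇑T ⁻¹' A = A → μ A = 0 ∨ μ Aᶜ = 0)
    {A B : Set X} (hA : MeasurableSet A) (hB : MeasurableSet B) (hA0 : μ A ≠ 0) (hB0 : μ B ≠ 0) :
    ∃ k : ℕ, μ (A ∩ iterZ T.toEquiv k ⁻¹' B) ≠ 0 := by
  obtain ⟨k, hk⟩ := exists_int_measure_inter_preimage_ne_zero hT herg hB hA0 hB0
  have hE : MeasurableSet (A ∩ iterZ T.toEquiv k ⁻¹' B) := hA.inter ((hT k).measurable hB)
  obtain ⟨n, hn, hne⟩ := frequently_atTop.1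
    (hcons.frequently_measure_inter_ne_zero hE.nullMeasurableSet hk) (-k).toNat
  refine ⟨(k + n).toNat, fun h => hne (measure_mono_null ?_ h)⟩
  rw [Int.toNat_of_nonneg (by lia), ← iterZ_natCast]
  rintro x ⟨hx, hx'⟩
  refine ⟨hx.1, ?_⟩
  rw [mem_preimage, iterZ_add_apply]
  exact hx'.2

end IntegerIterates

/-- If an invertible nonsingular ergodic transformation `T` is not weak doubly ergodic,
then there are positive measure sets `A`, `B` such that the `(T×T)`-orbits of `A × A` and
of `A × B` intersect in a `(μ×μ)`-null set. -/
theorem not_wde_invariant_sets {X : Type*} [MeasurableSpace X] (μ : Measure X)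
    [SigmaFinite μ] (T : X ≃ᵐ X)
    (hns : Measure.QuasiMeasurePreserving (⇑T) μ μ)
    (hns' : Measure.QuasiMeasurePreserving (⇑T.symm) μ μ)
    (herg : ∀ A : Set X, MeasurableSet A → ⇑T ⁻¹' A = A → μ A = 0 ∨ μ Aᶜ = 0)
    (hnwde : ¬ WDE μ T) :
    ∃ A B : Set X, MeasurableSet A ∧ MeasurableSet B ∧ 0 < μ A ∧ 0 < μ B ∧
      (μ.prod μ)
        ((⋃ n : ℤ, (iterZ T.toEquiv n '' A) ×ˢ (iterZ T.toEquiv n '' A)) ∩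
          (⋃ n : ℤ, (iterZ T.toEquiv n '' A) ×ˢ (iterZ T.toEquiv n '' B))) = 0 := by
  have hT := quasiMeasurePreserving_iterZ hns hns'
  by_cases hcons : Conservative (⇑T) μ
  · unfold WDE at hnwde
    push Not at hnwde
    obtain ⟨A, B, hA, hB, hA0, hB0, hAB⟩ := hnwde
    obtain ⟨k, hk⟩ := exists_nat_measure_inter_preimage_ne_zero_of_conservative hcons hT herg hA hB
      hA0.ne' hB0.ne'
    set C := A ∩ iterZ T.toEquiv k ⁻¹' B with hCdef
    have hC : MeasurableSet C := hA.inter ((hT k).measurable hB)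
    have hCret (n : ℤ) (hn : 1 ≤ n) : μ (C ∩ iterZ T.toEquiv n ⁻¹' C) = 0 ∨
        μ (C ∩ iterZ T.toEquiv (k - n) ⁻¹' C) = 0 := by
      lift n to ℕ using by lia
      have hBA := hAB n (by lia)
      rw [← iterZ_natCast, image_iterZ] at hBA
      refine or_iff_not_imp_left.2 fun hne => ?_
      have hA_ne : 0 < μ (A ∩ iterZ T.toEquiv (-n) ⁻¹' A) := by
        refine pos_iff_ne_zero.2 fun h => hne ?_
        have h' := measure_preimage_iterZ_inter_eq_zero_iff hT n 0 A A
        rw [zero_sub, iterZ_zero_preimage, inter_comm] at h'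
        exact measure_mono_null
          (inter_subset_inter inter_subset_left (preimage_mono inter_subset_left)) (h'.2 h)
      have h0 : μ (B ∩ iterZ T.toEquiv (-n) ⁻¹' A) = 0 := nonpos_iff_eq_zero.1 (hBA hA_ne)
      have h' := measure_preimage_iterZ_inter_eq_zero_iff hT k (k - n) B A
      rw [show (k - n - k : ℤ) = -n by ring] at h'
      exact measure_mono_null
        (inter_subset_inter inter_subset_right (preimage_mono inter_subset_left)) (h'.2 h0)
    rcases Nat.eq_zero_or_pos k with rfl | hkpos
    · refine exists_orbits_inter_null_of_wandering hT hC (pos_iff_ne_zero.2 hk) fun n hn => ?_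
      refine (hCret n hn).elim id fun h => ?_
      rw [Nat.cast_zero, zero_sub] at h
      have h' := measure_preimage_iterZ_inter_eq_zero_iff hT n 0 C C
      rw [zero_sub, iterZ_zero_preimage, inter_comm] at h'
      exact h'.2 h
    · exact exists_orbits_inter_null hT hC (pos_iff_ne_zero.2 hk) (by exact_mod_cast hkpos) hCret
  · obtain ⟨C, hC, hC0, hwander⟩ : ∃ C, MeasurableSet C ∧ μ C ≠ 0 ∧
        ∀ x ∈ C, ∀ m ≠ 0, (⇑T)^[m] x ∉ C := by
      by_contra! h
      exact hcons ⟨hns, fun s hs hs0 => h s hs hs0⟩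
    refine exists_orbits_inter_null_of_wandering hT hC (pos_iff_ne_zero.2 hC0) fun n hn => ?_
    lift n to ℕ using by lia
    rw [iterZ_natCast]
    convert measure_empty (μ := μ)
    exact eq_empty_of_forall_notMem fun x hx => hwander x hx.1 n (by lia) hx.2
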